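/- arXiv:math/0502084 — 2 statements merged into one kernel-verified Lean document; each statement's English description precedes it below -/
import Mathlib

section
/- Let k be a field of characteristic 0. If g ∈ k[x,y] is a homogeneous polynomial of degree n ≥ 1 satisfying g(x−z, y−z) + g(x,z) − g(y,z) − g(x,y) = 0 in k[x,y,z], then g is a scalar multiple of x^n − y^n − (x−y)^n. -/
open MvPolynomial

theorem aux_hom {k : Type*} [Field k] (n : ℕ)
    (g : MvPolynomial (Fin 2) k) (hg : g.IsHomogeneous n) (c : k) (v : Fin 2 → k) :
    eval (fun i => c * v i) g = c ^ n * eval v g := by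
  rw [eval_eq', eval_eq', Finset.mul_sum]
  refine Finset.sum_congr rfl fun m hm => ?_
  have h := hg (mem_support_iff.1 hm)
  rw [Finsupp.weight_apply, Finsupp.sum_fintype _ _ (by simp)] at h
  simp [Fin.sum_univ_two] at h
  simp only [Fin.prod_univ_two, ← h]
  ring

theorem aux_coeff {k : Type*} [Field k]
    (g : MvPolynomial (Fin 2) k) 
    (h0 : ∀ m : Fin 2 →₀ ℕ, m 1 = 1 → coeff m g = 0) (r : Polynomial k) :
    (aeval ![Polynomial.C r, (Polynomial.X : Polynomial (Polynomial k))] g).coeff 1 = 0 := by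
  rw [aeval_def, eval₂_eq', Polynomial.finsetSum_coeff]
  refine Finset.sum_eq_zero fun m hm => ?_
  have hm1 : m 1 ≠ 1 := fun h => mem_support_iff.1 hm (h0 m h)
  simp only [Fin.prod_univ_two, Matrix.cons_val_zero, Matrix.cons_val_one]
  rw [← mul_assoc, ← Polynomial.C_pow, IsScalarTower.algebraMap_apply k (Polynomial k) (Polynomial (Polynomial k)),
    Polynomial.algebraMap_eq, ← Polynomial.C_mul, Polynomial.coeff_C_mul_X_pow, if_neg (Ne.symm hm1)]

theorem aux_zero {k : Type*} [Field k] [CharZero k] (n : ℕ) (hn : 1 ≤ n)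
    (g : MvPolynomial (Fin 2) k) (hg : g.IsHomogeneous n)
    (heq :
      aeval ![(X 0 : MvPolynomial (Fin 3) k) - X 2, X 1 - X 2] g
        + aeval ![(X 0 : MvPolynomial (Fin 3) k), X 2] g
        - aeval ![(X 1 : MvPolynomial (Fin 3) k), X 2] g
        - aeval ![(X 0 : MvPolynomial (Fin 3) k), X 1] g = 0)
    (h0 : ∀ m : Fin 2 →₀ ℕ, m 1 = 1 → coeff m g = 0) : g = 0 := by
  -- transfer to any algebra
  have key : ∀ (A : Type _) [CommRing A] [Algebra k A] (x y z : A),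
      aeval ![x - z, y - z] g + aeval ![x, z] g - aeval ![y, z] g - aeval ![x, y] g = 0 := by
    intro A _ _ x y z
    have h := congrArg (aeval (R := k) ![x, y, z]) heq
    simp only [map_add, map_sub, map_zero, ← AlgHom.comp_apply, comp_aeval] at h
    have e : ∀ p q : MvPolynomial (Fin 3) k, (fun i => (aeval (R := k) ![x, y, z]) (![p, q] i))
        = ![aeval (R := k) ![x, y, z] p, aeval (R := k) ![x, y, z] q] := by
      intro p q
      funext i; fin_cases i <;> simp
    simpa only [e, map_sub, aeval_X, Matrix.cons_val] using h
  have ev : ∀ x y z : k, eval ![x - z, y - z] g + eval ![x, z] g - eval ![y, z] g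
      - eval ![x, y] g = 0 := by
    intro x y z
    simpa [aeval_eq_eval] using key k x y z
  have hom := aux_hom n g hg
  have hom2 : ∀ c a b : k, eval ![c * a, c * b] g = c ^ n * eval ![a, b] g := by
    intro c a b
    rw [← hom c ![a, b]]
    congr 2
    ext i; fin_cases i <;> simp
  have h00 : eval ![0, 0] g = 0 := by
    have := hom2 0 0 0
    simpa [zero_pow (show n ≠ 0 by omega)] using this
  have hx0 : ∀ a, eval ![a, 0] g = 0 := by
    intro a
    have := ev a 0 0
    simp only [sub_zero, h00] at this
    linear_combination this
  have hxx : ∀ a, eval ![a, a] g = 0 := by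
    intro a
    have := ev (a + a) a a
    simp only [add_sub_cancel_right, sub_self, hx0] at this
    linear_combination -this
  -- the one-variable polynomial
  let H : Polynomial k := aeval ![1 + Polynomial.X, Polynomial.X] g
  have hH : ∀ t, H.eval t = eval ![1 + t, t] g := by
    intro t
    have : (Polynomial.aeval t) H = aeval ![1 + t, t] g := by
      simp only [H, ← AlgHom.comp_apply, comp_aeval]
      congr 2
      ext i; fin_cases i <;> simp
    simpa [aeval_eq_eval] using this
  have hd : Polynomial.derivative H = 0 := by
    have h := key (Polynomial (Polynomial k)) (Polynomial.C (1 + Polynomial.X))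
      (Polynomial.C Polynomial.X) Polynomial.X
    have h1 := congrArg (fun p => Polynomial.coeff p 1) h
    simp only [Polynomial.coeff_sub, Polynomial.coeff_add, aux_coeff g h0,
      Polynomial.coeff_zero] at h1
    have e1 : aeval ![Polynomial.C (1 + Polynomial.X), (Polynomial.C Polynomial.X : Polynomial (Polynomial k))] g = Polynomial.C H := by
      have : (Polynomial.CAlgHom (R := k) (A := Polynomial k)) H = aeval ![Polynomial.C (1 + Polynomial.X), (Polynomial.C Polynomial.X : Polynomial (Polynomial k))] g := by
        simp only [H, ← AlgHom.comp_apply, comp_aeval]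
        congr 2
        ext1 i; fin_cases i <;> simp
      rw [← this]; rfl
    have e2 : aeval ![Polynomial.C (1 + Polynomial.X) - Polynomial.X, (Polynomial.C Polynomial.X - Polynomial.X : Polynomial (Polynomial k))] g = (H.map Polynomial.C).comp (Polynomial.C Polynomial.X - Polynomial.X) := by
      have : Polynomial.aeval (Polynomial.C Polynomial.X - Polynomial.X : Polynomial (Polynomial k)) H = aeval ![Polynomial.C (1 + Polynomial.X) - Polynomial.X, (Polynomial.C Polynomial.X - Polynomial.X : Polynomial (Polynomial k))] g := by
        simp only [H, ← AlgHom.comp_apply, comp_aeval]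
        congr 2
        ext1 i; fin_cases i
        · simp; ring
        · simp
      rw [← this, Polynomial.comp, Polynomial.eval₂_map]; rfl
    rw [e1, e2, Polynomial.coeff_C_succ] at h1
    have h2 : (Polynomial.derivative ((H.map Polynomial.C).comp (Polynomial.C Polynomial.X - Polynomial.X))).eval 0 = 0 := by
      rw [← Polynomial.coeff_zero_eq_eval_zero, Polynomial.coeff_derivative]
      simpa using h1
    rw [Polynomial.derivative_comp, Polynomial.derivative_map] at h2
    simpa [Polynomial.eval_comp, Polynomial.eval_map, Polynomial.eval₂_C_X] using h2
  have hH0 : ∀ t, H.eval t = 0 := by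
    intro t
    rw [Polynomial.eq_C_of_derivative_eq_zero hd, Polynomial.eval_C,
      Polynomial.coeff_zero_eq_eval_zero, hH]
    simpa using hx0 1
  apply MvPolynomial.funext
  intro v
  have hv : v = ![v 0, v 1] := by ext i; fin_cases i <;> rfl
  rw [hv, map_zero]
  by_cases hab : v 0 = v 1
  · rw [hab]; exact hxx _
  · have hne : v 0 - v 1 ≠ 0 := sub_ne_zero.2 hab
    have := hom2 (v 0 - v 1) (1 + v 1 / (v 0 - v 1)) (v 1 / (v 0 - v 1))
    rw [← hH, hH0, mul_zero] at this
    rw [← this]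
    congr 3
    · field_simp; ring
    · congr 1; field_simp

theorem stmt0 (k : Type*) [Field k] [CharZero k] (n : ℕ) (hn : 1 ≤ n)
    (g : MvPolynomial (Fin 2) k) (hg : g.IsHomogeneous n)
    (heq :
      aeval ![(X 0 : MvPolynomial (Fin 3) k) - X 2, X 1 - X 2] g
        + aeval ![(X 0 : MvPolynomial (Fin 3) k), X 2] g
        - aeval ![(X 1 : MvPolynomial (Fin 3) k), X 2] g
        - aeval ![(X 0 : MvPolynomial (Fin 3) k), X 1] g = 0) :
    ∃ c : k, g = c • ((X 0 : MvPolynomial (Fin 2) k) ^ n - X 1 ^ n - (X 0 - X 1) ^ n) := by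
  set P : MvPolynomial (Fin 2) k := (X 0 : MvPolynomial (Fin 2) k) ^ n - X 1 ^ n - (X 0 - X 1) ^ n with hP
  have hPh : P.IsHomogeneous n := by
    have h0 := isHomogeneous_X k (0 : Fin 2)
    have h1 := isHomogeneous_X k (1 : Fin 2)
    have a := h0.pow n
    have b := h1.pow n
    have c := (h0.sub h1).pow n
    rw [one_mul] at a b c
    exact (a.sub b).sub c
  -- subtraction lemma
  have main : ∀ c : k, (∀ m : Fin 2 →₀ ℕ, m 1 = 1 → coeff m (g - c • P) = 0) → g = c • P := by
    intro c hc
    rw [← sub_eq_zero]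
    refine aux_zero n hn _ (hg.sub ?_) ?_ hc
    · rw [smul_eq_C_mul]
      exact hPh.C_mul c
    · simp only [map_sub, map_smul, hP, map_pow, aeval_X, Matrix.cons_val_zero, Matrix.cons_val_one]
      rw [← sub_eq_zero] at heq
      simp only [smul_eq_C_mul]
      rw [sub_zero] at heq
      have e : (X 0 - X 2 - (X 1 - X 2) : MvPolynomial (Fin 3) k) = X 0 - X 1 := by ring
      rw [e]
      linear_combination heq
  have hdeg : ∀ f : MvPolynomial (Fin 2) k, f.IsHomogeneous n → ∀ m : Fin 2 →₀ ℕ, m 1 = 1 →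
      coeff m f ≠ 0 → m = Finsupp.single 0 (n - 1) + Finsupp.single 1 1 := by
    intro f hf m hm hne
    have h := hf hne
    rw [Finsupp.weight_apply, Finsupp.sum_fintype _ _ (by simp)] at h
    simp [Fin.sum_univ_two] at h
    ext i; fin_cases i
    · simp; omega
    · simpa using hm
  set M : Fin 2 →₀ ℕ := Finsupp.single 0 (n - 1) + Finsupp.single 1 1 with hM
  rcases Nat.lt_or_ge 1 n with h2 | h2
  · have hcP : coeff M P ≠ 0 := by
      intro h0
      have hP0 : P = 0 := by
        refine aux_zero n hn P hPh ?_ fun m hm => ?_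
        · simp only [map_sub, hP, map_pow, aeval_X, Matrix.cons_val_zero, Matrix.cons_val_one]
          have e : (X 0 - X 2 - (X 1 - X 2) : MvPolynomial (Fin 3) k) = X 0 - X 1 := by ring
          rw [e]
          ring
        · by_contra hne
          have := hdeg _ hPh m hm hne
          subst this
          exact hne h0
      have h3 := congrArg (eval ![(2 : k), 1]) hP0
      simp only [hP, map_sub, map_pow, eval_X, Matrix.cons_val_zero, Matrix.cons_val_one,
        map_zero, one_pow] at h3
      have h4 : ((2 ^ n : ℕ) : k) = ((2 : ℕ) : k) := by
        push_cast
        have h5 : (2 - 1 : k) ^ n = 1 := by norm_num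
        linear_combination h3 + h5
      have h6 : 2 ^ n = 2 := Nat.cast_injective h4
      have h7 : 2 ^ 1 < 2 ^ n := Nat.pow_lt_pow_right (by norm_num) h2
      omega
    refine ⟨coeff M g / coeff M P, main _ fun m hm => ?_⟩
    by_contra hne
    have := hdeg _ (hg.sub (by rw [smul_eq_C_mul]; exact hPh.C_mul _)) m hm hne
    subst this
    apply hne
    rw [coeff_sub, coeff_smul, smul_eq_mul]
    field_simp
    ring
  · obtain rfl : n = 1 := by omega
    refine ⟨0, ?_⟩
    have hmem : g ∈ homogeneousSubmodule (Fin 2) k 1 := hg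
    rw [homogeneousSubmodule_one_eq_span_X, Submodule.mem_span_range_iff_exists_fun] at hmem
    obtain ⟨c, rfl⟩ := hmem
    have h1 := congrArg (eval ![(1 : k), 0, 0]) heq
    have h3 := congrArg (eval ![(0 : k), 0, 1]) heq
    simp [Fin.sum_univ_two, smul_eq_C_mul] at h1 h3
    simp [Fin.sum_univ_two, h1] at h3 ⊢
    simp [h3]
end

section
/- Let 𝔱4 be the Drinfeld–Kohno Lie algebra on 4 strands (generators t_{ij} = t_{ji}, 1 ≤ i < j ≤ 4, with relations [t_{ij}+t_{ik}, t_{jk}] = 0 for distinct i,j,k and [t_{ij}, t_{kl}] = 0 for distinct i,j,k,l). Let ε4 : 𝔱4 → 𝔱3 be the Lie algebra morphism sending t_{ij} ↦ t_{ij} for i < j < 4 and t_{i4} ↦ 0. Then the kernel of ε4 is the Lie subalgebra generated by t_{14}, t_{24}, t_{34}, and this subalgebra is free on these three generators. -/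
set_option linter.all false

namespace DK

universe u
variable {k : Type u} [Field k]

/-- square-zero extension of a Lie algebra by its adjoint module -/
def Sq (L : Type*) := L × L

/-- constructor -/
def Sq.mk {L : Type*} (a b : L) : Sq L := (a, b)

section
variable {L : Type*} [LieRing L] [LieAlgebra k L]

instance : AddCommGroup (Sq L) := inferInstanceAs (AddCommGroup (L × L))
instance : Module k (Sq L) := inferInstanceAs (Module k (L × L))

instance : Bracket (Sq L) (Sq L) where
  bracket x y := (⁅x.1, y.1⁆, ⁅x.1, y.2⁆ - ⁅y.1, x.2⁆)

theorem Sq.ext' {x y : Sq L} (h1 : x.1 = y.1) (h2 : x.2 = y.2) : x = y := Prod.ext h1 h2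
@[simp] theorem Sq.add1 (x y : Sq L) : (x + y).1 = x.1 + y.1 := rfl
@[simp] theorem Sq.add2 (x y : Sq L) : (x + y).2 = x.2 + y.2 := rfl
@[simp] theorem Sq.zero1 : (0 : Sq L).1 = 0 := rfl
@[simp] theorem Sq.zero2 : (0 : Sq L).2 = 0 := rfl
@[simp] theorem Sq.smul1 (c : k) (x : Sq L) : (c • x).1 = c • x.1 := rfl
@[simp] theorem Sq.smul2 (c : k) (x : Sq L) : (c • x).2 = c • x.2 := rfl
@[simp] theorem Sq.lie1 (x y : Sq L) : (⁅x, y⁆).1 = ⁅x.1, y.1⁆ := rfl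
@[simp] theorem Sq.lie2 (x y : Sq L) : (⁅x, y⁆).2 = ⁅x.1, y.2⁆ - ⁅y.1, x.2⁆ := rfl

instance : LieRing (Sq L) where
  add_lie x y z := by apply Sq.ext' <;> simp; abel
  lie_add x y z := by apply Sq.ext' <;> simp; abel
  lie_self x := by apply Sq.ext' <;> simp
  leibniz_lie x y z := by
    apply Sq.ext'
    · simp
    · simp only [Sq.lie2, Sq.add2, Sq.lie1, lie_sub, lie_lie]
      abel

instance : LieAlgebra k (Sq L) where
  lie_smul c x y := by apply Sq.ext' <;> simp [smul_sub]

/-- first projection -/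
def Sq.p1 : Sq L →ₗ⁅k⁆ L where
  toFun x := x.1
  map_add' _ _ := rfl
  map_smul' _ _ := rfl
  map_lie' := rfl
end

open FreeLieAlgebra

theorem mem_of_gen {X : Type*} (S : LieSubalgebra k (FreeLieAlgebra k X))
    (h : ∀ x, of k x ∈ S) (z : FreeLieAlgebra k X) : z ∈ S := by
  have : (S.incl).comp (lift k (fun x => (⟨of k x, h x⟩ : S))) = LieHom.id := by
    ext x; simp
  have h2 := LieHom.congr_fun this z
  have h3 : ((lift k (fun x => (⟨of k x, h x⟩ : S)) z : S) : FreeLieAlgebra k X) = z := h2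
  rw [← h3]; exact Subtype.property _

theorem sq_fst {X : Type*} (f : X → FreeLieAlgebra k X) (z : FreeLieAlgebra k X) :
    (lift k (fun x => Sq.mk (of k x) (f x)) z).1 = z := by
  have : (Sq.p1).comp (lift k (fun x => Sq.mk (of k x) (f x)))
      = LieHom.id := by
    ext x; simp only [LieHom.comp_apply, lift_of_apply]; rfl
  exact LieHom.congr_fun this z

/-- derivation of the free Lie algebra with prescribed values -/
noncomputable def der {X : Type*} (f : X → FreeLieAlgebra k X) :
    LieDerivation k (FreeLieAlgebra k X) (FreeLieAlgebra k X) where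
  toFun z := (lift k (fun x => Sq.mk (of k x) (f x)) z).2
  map_add' x y := by rw [map_add]; rfl
  map_smul' c x := by rw [map_smul]; rfl
  leibniz' a b := by
    simp only [LinearMap.coe_mk, AddHom.coe_mk]
    rw [LieHom.map_lie, Sq.lie2, sq_fst, sq_fst]

@[simp] theorem der_of {X : Type*} (f : X → FreeLieAlgebra k X) (x : X) :
    der f (of k x) = f x := by
  change (lift k (fun x => Sq.mk (of k x) (f x)) (of k x)).2 = f x
  rw [lift_of_apply]; rfl

theorem der_ext {X : Type*} {D E : LieDerivation k (FreeLieAlgebra k X) (FreeLieAlgebra k X)}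
    (h : ∀ x, D (of k x) = E (of k x)) : D = E := by
  ext z
  let S : LieSubalgebra k (FreeLieAlgebra k X) :=
    { carrier := {z | D z = E z}
      add_mem' := by intro a b ha hb; simp_all
      zero_mem' := by simp
      smul_mem' := by intro c a ha; simp_all
      lie_mem' := by intro a b ha hb; simp_all }
  exact mem_of_gen S h z

theorem range_stable {X : Type*} {T : Type*} [LieRing T] [LieAlgebra k T]
    (φ : FreeLieAlgebra k X →ₗ⁅k⁆ T) (t : T) (h : ∀ i, ⁅t, φ (of k i)⁆ ∈ φ.range) (z) :
    ⁅t, φ z⁆ ∈ φ.range := by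
  let S : LieSubalgebra k (FreeLieAlgebra k X) :=
    { carrier := {z | ⁅t, φ z⁆ ∈ φ.range}
      add_mem' := by
        intro a b ha hb
        simp only [Set.mem_ofPred_eq, map_add, lie_add] at *
        exact add_mem ha hb
      zero_mem' := by
        simp only [Set.mem_ofPred_eq, map_zero, lie_zero]; exact zero_mem _
      smul_mem' := by
        intro c a ha
        simp only [Set.mem_ofPred_eq, map_smul, lie_smul] at *
        exact φ.range.smul_mem c ha
      lie_mem' := by
        intro a b ha hb
        simp only [Set.mem_ofPred_eq, LieHom.map_lie] at *
        rw [leibniz_lie]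
        exact add_mem (φ.range.lie_mem ha ⟨b, rfl⟩) (φ.range.lie_mem ⟨a, rfl⟩ hb) }
  exact mem_of_gen S h z

/-- quotient map as a Lie hom -/
def mkHom {L : Type*} [LieRing L] [LieAlgebra k L] (I : LieIdeal k L) : L →ₗ⁅k⁆ L ⧸ I where
  toFun x := LieSubmodule.Quotient.mk (N := I) x
  map_add' _ _ := rfl
  map_smul' _ _ := rfl
  map_lie' := rfl

theorem mkHom_eq_zero {L : Type*} [LieRing L] [LieAlgebra k L] (I : LieIdeal k L) (x : L) :
    mkHom I x = 0 ↔ x ∈ I := LieSubmodule.Quotient.mk_eq_zero' (N := I)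

variable (k) in
/-- D12 -/
noncomputable def D12 := der (k := k) (X := Fin 3) ![⁅of k (0 : Fin 3), of k (1 : Fin 3)⁆, ⁅of k (1 : Fin 3), of k (0 : Fin 3)⁆, 0]
variable (k) in
/-- D13 -/
noncomputable def D13 := der (k := k) (X := Fin 3) ![⁅of k (0 : Fin 3), of k (2 : Fin 3)⁆, 0, ⁅of k (2 : Fin 3), of k (0 : Fin 3)⁆]
variable (k) in
/-- D23 -/
noncomputable def D23 := der (k := k) (X := Fin 3) ![0, ⁅of k (1 : Fin 3), of k (2 : Fin 3)⁆, ⁅of k (2 : Fin 3), of k (1 : Fin 3)⁆]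

theorem J3 : ⁅of k (2 : Fin 3), ⁅of k (0 : Fin 3), of k (1 : Fin 3)⁆⁆ =
    ⁅of k (1 : Fin 3), ⁅of k (0 : Fin 3), of k (2 : Fin 3)⁆⁆ -
      ⁅of k (0 : Fin 3), ⁅of k (1 : Fin 3), of k (2 : Fin 3)⁆⁆ := by
  rw [← lie_skew, lie_lie]; abel

theorem r1 : ⁅D12 k + D13 k, D23 k⁆ = 0 := by
  apply der_ext
  intro i
  fin_cases i <;>
  simp [D12, D13, D23, LieDerivation.lie_apply, -lie_skew] <;>
  try simp only [← lie_skew (of k (1 : Fin 3)) (of k (0 : Fin 3)),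
    ← lie_skew (of k (2 : Fin 3)) (of k (0 : Fin 3)),
    ← lie_skew (of k (2 : Fin 3)) (of k (1 : Fin 3)), lie_neg, neg_lie, J3, lie_zero, zero_lie] <;> try abel
theorem r2 : ⁅D12 k + D23 k, D13 k⁆ = 0 := by
  apply der_ext
  intro i
  fin_cases i <;>
  simp [D12, D13, D23, LieDerivation.lie_apply, -lie_skew] <;>
  try simp only [← lie_skew (of k (1 : Fin 3)) (of k (0 : Fin 3)),
    ← lie_skew (of k (2 : Fin 3)) (of k (0 : Fin 3)),
    ← lie_skew (of k (2 : Fin 3)) (of k (1 : Fin 3)), lie_neg, neg_lie, J3, lie_zero, zero_lie] <;> try abel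

theorem r3 : ⁅D13 k + D23 k, D12 k⁆ = 0 := by
  apply der_ext
  intro i
  fin_cases i <;>
  simp [D12, D13, D23, LieDerivation.lie_apply, -lie_skew] <;>
  try simp only [← lie_skew (of k (1 : Fin 3)) (of k (0 : Fin 3)),
    ← lie_skew (of k (2 : Fin 3)) (of k (0 : Fin 3)),
    ← lie_skew (of k (2 : Fin 3)) (of k (1 : Fin 3)), lie_neg, neg_lie, J3, lie_zero, zero_lie] <;> try abel


theorem inj (I : LieIdeal k (FreeLieAlgebra k (Fin 6)))
    (hI : ∀ {M : Type u} [LieRing M] [LieAlgebra k M] (Φ : FreeLieAlgebra k (Fin 6) →ₗ⁅k⁆ M),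
      ⁅Φ (of k 0) + Φ (of k 1), Φ (of k 3)⁆ = 0 → ⁅Φ (of k 0) + Φ (of k 3), Φ (of k 1)⁆ = 0 →
      ⁅Φ (of k 1) + Φ (of k 3), Φ (of k 0)⁆ = 0 →
      ⁅Φ (of k 0) + Φ (of k 2), Φ (of k 4)⁆ = 0 → ⁅Φ (of k 0) + Φ (of k 4), Φ (of k 2)⁆ = 0 →
      ⁅Φ (of k 2) + Φ (of k 4), Φ (of k 0)⁆ = 0 →
      ⁅Φ (of k 1) + Φ (of k 2), Φ (of k 5)⁆ = 0 → ⁅Φ (of k 1) + Φ (of k 5), Φ (of k 2)⁆ = 0 →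
      ⁅Φ (of k 2) + Φ (of k 5), Φ (of k 1)⁆ = 0 →
      ⁅Φ (of k 3) + Φ (of k 4), Φ (of k 5)⁆ = 0 → ⁅Φ (of k 3) + Φ (of k 5), Φ (of k 4)⁆ = 0 →
      ⁅Φ (of k 4) + Φ (of k 5), Φ (of k 3)⁆ = 0 →
      ⁅Φ (of k 0), Φ (of k 5)⁆ = 0 → ⁅Φ (of k 1), Φ (of k 4)⁆ = 0 →
      ⁅Φ (of k 2), Φ (of k 3)⁆ = 0 → I ≤ Φ.ker) :
    Function.Injective (lift k ![mkHom I (of k 2), mkHom I (of k 4), mkHom I (of k 5)]) := by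
  let ψ : LieDerivation k (FreeLieAlgebra k (Fin 3)) (FreeLieAlgebra k (Fin 3)) →ₗ⁅k⁆
    LieDerivation k (FreeLieAlgebra k (Fin 3)) (FreeLieAlgebra k (Fin 3)) := LieHom.id
  let Φ : FreeLieAlgebra k (Fin 6) →ₗ⁅k⁆ LieAlgebra.SemiDirectSum _ _ ψ :=
    lift k ![⟨0, D12 k⟩, ⟨0, D13 k⟩, ⟨of k 0, 0⟩, ⟨0, D23 k⟩, ⟨of k 1, 0⟩, ⟨of k 2, 0⟩]
  have h : I ≤ Φ.ker := by
    apply hI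
    · simpa [Φ] using r1
    · simpa [Φ] using r2
    · simpa [Φ] using r3
    all_goals simp [Φ, ψ, D12, D13, D23, -lie_skew]
    all_goals
      rw [← lie_skew]; abel
  let g : FreeLieAlgebra k (Fin 3) →ₗ⁅k⁆ FreeLieAlgebra k (Fin 6) :=
    lift k ![of k 2, of k 4, of k 5]
  have e1 : lift k ![mkHom I (of k 2), mkHom I (of k 4), mkHom I (of k 5)] = (mkHom I).comp g := by
    ext i; fin_cases i <;> simp [g]
  have e2 : Φ.comp g = LieAlgebra.SemiDirectSum.inl ψ := by
    ext i : 1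
    fin_cases i <;> simp [g, Φ]
  rw [e1, ← LieHom.coe_toLinearMap, ← LinearMap.ker_eq_bot, LinearMap.ker_eq_bot']
  intro z hz
  have h1 : g z ∈ I := (mkHom_eq_zero I _).1 hz
  have h2 : Φ (g z) = 0 := h h1
  have h3 := LieHom.congr_fun e2 z
  rw [LieHom.comp_apply, h2] at h3
  exact (LieAlgebra.SemiDirectSum.inl_injective ψ (h3.symm.trans (map_zero _).symm))

theorem kerpart {T4 : Type u} [LieRing T4] [LieAlgebra k T4] (I3 : LieIdeal k (FreeLieAlgebra k (Fin 3)))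
    (q : FreeLieAlgebra k (Fin 6) →ₗ⁅k⁆ T4) (hq : Function.Surjective q)
    (hI : ∀ {M : Type u} [LieRing M] [LieAlgebra k M] (Φ : FreeLieAlgebra k (Fin 3) →ₗ⁅k⁆ M),
      ⁅Φ (of k 0) + Φ (of k 1), Φ (of k 2)⁆ = 0 → ⁅Φ (of k 0) + Φ (of k 2), Φ (of k 1)⁆ = 0 →
      ⁅Φ (of k 1) + Φ (of k 2), Φ (of k 0)⁆ = 0 → I3 ≤ Φ.ker)
    (h1 : ⁅q (of k 0) + q (of k 1), q (of k 3)⁆ = 0)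
    (h2 : ⁅q (of k 0) + q (of k 3), q (of k 1)⁆ = 0)
    (h3 : ⁅q (of k 1) + q (of k 3), q (of k 0)⁆ = 0)
    (h4 : ⁅q (of k 0) + q (of k 2), q (of k 4)⁆ = 0)
    (h5 : ⁅q (of k 0) + q (of k 4), q (of k 2)⁆ = 0)
    (h6 : ⁅q (of k 1) + q (of k 2), q (of k 5)⁆ = 0)
    (h7 : ⁅q (of k 1) + q (of k 5), q (of k 2)⁆ = 0)
    (h8 : ⁅q (of k 3) + q (of k 4), q (of k 5)⁆ = 0)
    (h9 : ⁅q (of k 3) + q (of k 5), q (of k 4)⁆ = 0)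
    (h10 : ⁅q (of k 0), q (of k 5)⁆ = 0)
    (h11 : ⁅q (of k 1), q (of k 4)⁆ = 0)
    (h12 : ⁅q (of k 2), q (of k 3)⁆ = 0)
    (ε : T4 →ₗ⁅k⁆ FreeLieAlgebra k (Fin 3) ⧸ I3)
    (e0 : ε (q (of k 0)) = mkHom I3 (of k 0)) (e1 : ε (q (of k 1)) = mkHom I3 (of k 1))
    (e3 : ε (q (of k 3)) = mkHom I3 (of k 2))
    (e2 : ε (q (of k 2)) = 0) (e4 : ε (q (of k 4)) = 0) (e5 : ε (q (of k 5)) = 0) (v : T4) :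
    ε v = 0 ↔ v ∈ (lift k ![q (of k 2), q (of k 4), q (of k 5)]).range := by
  set φ := lift k ![q (of k 2), q (of k 4), q (of k 5)] with hφ
  have f0 : φ (of k 0) = q (of k 2) := by simp [hφ]
  have f1 : φ (of k 1) = q (of k 4) := by simp [hφ]
  have f2 : φ (of k 2) = q (of k 5) := by simp [hφ]
  have m0 : q (of k 2) ∈ φ.range := ⟨_, f0⟩
  have m1 : q (of k 4) ∈ φ.range := ⟨_, f1⟩
  have m2 : q (of k 5) ∈ φ.range := ⟨_, f2⟩
  rw [add_lie] at h4 h5 h6 h7 h8 h9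
  have st : ∀ w : FreeLieAlgebra k (Fin 6), w ∈ φ.range.normalizer.comap q := by
    apply mem_of_gen
    intro i
    change q (of k i) ∈ φ.range.normalizer
    rw [LieSubalgebra.mem_normalizer_iff]
    rintro _ ⟨z, rfl⟩
    apply range_stable
    intro j
    fin_cases i <;> fin_cases j <;> simp only [Fin.zero_eta, Fin.mk_one, Fin.reduceFinMk, f0, f1, f2]
    · rw [eq_neg_of_add_eq_zero_left h5]; exact neg_mem (φ.range.lie_mem m1 m0)
    · rw [eq_neg_of_add_eq_zero_left h4]; exact neg_mem (φ.range.lie_mem m0 m1)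
    · rw [h10]; exact zero_mem _
    · rw [eq_neg_of_add_eq_zero_left h7]; exact neg_mem (φ.range.lie_mem m2 m0)
    · rw [h11]; exact zero_mem _
    · rw [eq_neg_of_add_eq_zero_left h6]; exact neg_mem (φ.range.lie_mem m0 m2)
    all_goals try exact φ.range.lie_mem (by assumption) (by assumption)
    · rw [← lie_skew, h12, neg_zero]; exact zero_mem _
    · rw [eq_neg_of_add_eq_zero_left h9]; exact neg_mem (φ.range.lie_mem m2 m1)
    · rw [eq_neg_of_add_eq_zero_left h8]; exact neg_mem (φ.range.lie_mem m1 m2)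
  let J : LieIdeal k T4 :=
    { φ.range.toSubmodule with
      lie_mem := by
        intro x m hm
        obtain ⟨w, rfl⟩ := hq x
        have := st w
        exact (LieSubalgebra.mem_normalizer_iff _ _).1 this m hm }
  constructor
  · intro hv
    obtain ⟨w, rfl⟩ := hq v
    let p : FreeLieAlgebra k (Fin 6) →ₗ⁅k⁆ FreeLieAlgebra k (Fin 3) :=
      lift k ![of k 0, of k 1, 0, of k 2, 0, 0]
    have a1 : ε.comp q = (mkHom I3).comp p := by
      ext i
      fin_cases i <;> simp [p, e0, e1, e2, e3, e4, e5]
    let θ : FreeLieAlgebra k (Fin 3) →ₗ⁅k⁆ T4 ⧸ J :=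
      lift k ![mkHom J (q (of k 0)), mkHom J (q (of k 1)), mkHom J (q (of k 3))]
    have a2 : θ.comp p = (mkHom J).comp q := by
      have m0' : mkHom J (q (of k 2)) = 0 := (mkHom_eq_zero J _).2 m0
      have m1' : mkHom J (q (of k 4)) = 0 := (mkHom_eq_zero J _).2 m1
      have m2' : mkHom J (q (of k 5)) = 0 := (mkHom_eq_zero J _).2 m2
      ext i
      fin_cases i <;> simp [p, θ, m0', m1', m2']
    have a3 : I3 ≤ θ.ker := by
      apply hI <;> simp only [θ, lift_of_apply, Matrix.cons_val] <;>
        rw [← map_add, ← LieHom.map_lie] <;> simp only [h1, h2, h3, map_zero]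
    have b1 := LieHom.congr_fun a1 w
    rw [LieHom.comp_apply, hv] at b1
    have b2 : θ (p w) = 0 := a3 ((mkHom_eq_zero I3 _).1 b1.symm)
    have b3 := LieHom.congr_fun a2 w
    rw [LieHom.comp_apply, b2] at b3
    exact (mkHom_eq_zero J _).1 b3.symm
  · rintro ⟨z, rfl⟩
    have : ε.comp φ = 0 := by
      ext i
      fin_cases i <;> simp [f0, f1, f2, e2, e4, e5]
    exact LieHom.congr_fun this z

end DK


theorem stmt19 (k : Type*) [Field k] [CharZero k] :
    -- 𝔱3: generators 0 ↦ t12, 1 ↦ t13, 2 ↦ t23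
    let L3 := FreeLieAlgebra k (Fin 3)
    let u12 : L3 := FreeLieAlgebra.of k 0
    let u13 : L3 := FreeLieAlgebra.of k 1
    let u23 : L3 := FreeLieAlgebra.of k 2
    let I3 : LieIdeal k L3 :=
      LieSubmodule.lieSpan k L3 {⁅u12 + u13, u23⁆, ⁅u12 + u23, u13⁆, ⁅u13 + u23, u12⁆}
    let T3 := L3 ⧸ I3
    let s12 : T3 := LieSubmodule.Quotient.mk (N := I3) u12
    let s13 : T3 := LieSubmodule.Quotient.mk (N := I3) u13
    let s23 : T3 := LieSubmodule.Quotient.mk (N := I3) u23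
    -- 𝔱4: generators 0 ↦ t12, 1 ↦ t13, 2 ↦ t14, 3 ↦ t23, 4 ↦ t24, 5 ↦ t34
    let L4 := FreeLieAlgebra k (Fin 6)
    let v12 : L4 := FreeLieAlgebra.of k 0
    let v13 : L4 := FreeLieAlgebra.of k 1
    let v14 : L4 := FreeLieAlgebra.of k 2
    let v23 : L4 := FreeLieAlgebra.of k 3
    let v24 : L4 := FreeLieAlgebra.of k 4
    let v34 : L4 := FreeLieAlgebra.of k 5
    let I4 : LieIdeal k L4 :=
      LieSubmodule.lieSpan k L4
        ({⁅v12 + v13, v23⁆, ⁅v12 + v23, v13⁆, ⁅v13 + v23, v12⁆,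
          ⁅v12 + v14, v24⁆, ⁅v12 + v24, v14⁆, ⁅v14 + v24, v12⁆,
          ⁅v13 + v14, v34⁆, ⁅v13 + v34, v14⁆, ⁅v14 + v34, v13⁆,
          ⁅v23 + v24, v34⁆, ⁅v23 + v34, v24⁆, ⁅v24 + v34, v23⁆,
          ⁅v12, v34⁆, ⁅v13, v24⁆, ⁅v14, v23⁆} : Set L4)
    let T4 := L4 ⧸ I4
    let t12 : T4 := LieSubmodule.Quotient.mk (N := I4) v12
    let t13 : T4 := LieSubmodule.Quotient.mk (N := I4) v13
    let t14 : T4 := LieSubmodule.Quotient.mk (N := I4) v14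
    let t23 : T4 := LieSubmodule.Quotient.mk (N := I4) v23
    let t24 : T4 := LieSubmodule.Quotient.mk (N := I4) v24
    let t34 : T4 := LieSubmodule.Quotient.mk (N := I4) v34
    -- φ : free Lie algebra on 3 generators → 𝔱4, sending generators to t14, t24, t34
    let φ : FreeLieAlgebra k (Fin 3) →ₗ⁅k⁆ T4 := FreeLieAlgebra.lift k ![t14, t24, t34]
    ∀ ε : T4 →ₗ⁅k⁆ T3,
      ε t12 = s12 → ε t13 = s13 → ε t23 = s23 →
      ε t14 = 0 → ε t24 = 0 → ε t34 = 0 →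
      Function.Injective φ ∧ ∀ v : T4, ε v = 0 ↔ v ∈ φ.range := by
  intro L3 u12 u13 u23 I3 T3 s12 s13 s23 L4 v12 v13 v14 v23 v24 v34 I4 T4 t12 t13 t14 t23 t24 t34 φ
    ε e12 e13 e23 e14 e24 e34
  constructor
  · refine DK.inj I4 ?_
    intro M _ _ Φ h1 h2 h3 h4 h5 h6 h7 h8 h9 h10 h11 h12 h13 h14 h15
    rw [LieSubmodule.lieSpan_le]
    rintro x (rfl | rfl | rfl | rfl | rfl | rfl | rfl | rfl | rfl | rfl | rfl | rfl | rfl | rfl | rfl) <;>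
    · change Φ _ = 0
      rw [LieHom.map_lie]
      try rw [map_add]
      assumption
  · have rel : ∀ x ∈ _, DK.mkHom I4 x = 0 := fun x hx =>
      (DK.mkHom_eq_zero I4 x).2 (LieSubmodule.subset_lieSpan hx)
    refine DK.kerpart I3 (DK.mkHom I4) ?_ ?_ ?_ ?_ ?_ ?_ ?_ ?_ ?_ ?_ ?_ ?_ ?_ ?_ 
      ε e12 e13 e23 e14 e24 e34
    · exact Quot.mk_surjective
    · intro M _ _ Φ h1 h2 h3
      rw [LieSubmodule.lieSpan_le]
      rintro x (rfl | rfl | rfl) <;>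
      · change Φ _ = 0
        rw [LieHom.map_lie, map_add]
        assumption
    all_goals
      simp only [← map_add, ← LieHom.map_lie]
      apply rel
      simp only [Set.mem_insert_iff, Set.mem_singleton_iff, v12, v13, v14, v23, v24, v34, true_or, or_true]
end
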